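/- The sampled iteration count dominates the exact policy-iteration count: let η ∈ (0,1) and let K ≥ 1 be an integer such that ‖Q_π^K 𝟙‖_∞ ≤ 1 − η for every policy π, and assume 0 < Δ_★ ≤ 1. Then ‖w‖_∞ ≤ K/η and ⌈2‖w‖_∞ log(‖w‖_∞/Δ_★)⌉ ≤ ⌈(2K/η) log(K/(η Δ_★))⌉; in particular, exact policy iteration (π_{k+1} greedy with respect to q_{π_k}) started from any policy yields an optimal policy π_k for every k ≥ ⌈(2K/η) log(K/(η Δ_★))⌉. -/

import Mathlib

open Filter Matrix

noncomputable section

namespace MCES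

variable {S A : Type*} [Fintype S] [DecidableEq S] [Fintype A] [Nonempty S] [Nonempty A]

/-- The substochastic transition matrix on non-terminal states induced by a policy. -/
def Qmat (p : S → A → S → ℝ) (π : S → A) : Matrix S S ℝ := fun s s' => p s (π s) s'

/-- The reward vector induced by a policy. -/
def rvec (r : S → A → ℝ) (π : S → A) : S → ℝ := fun s => r s (π s)

/-- Value function of a policy: `v_π = (I − Q_π)⁻¹ r_π`. -/
def valueFn (p : S → A → S → ℝ) (r : S → A → ℝ) (π : S → A) : S → ℝ :=
  (1 - Qmat p π)⁻¹ *ᵥ rvec r π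

/-- Action-value function of a policy:
`q_π(s,a) = r(s,a) + ∑_{s'} p(s'|s,a) v_π(s')`. -/
def qFn (p : S → A → S → ℝ) (r : S → A → ℝ) (π : S → A) (s : S) (a : A) : ℝ :=
  r s a + ∑ s', p s a s' * valueFn p r π s'

/-- The optimal value function `v_★(s) = max_π v_π(s)`. -/
def vStar (p : S → A → S → ℝ) (r : S → A → ℝ) (s : S) : ℝ :=
  ⨆ π : S → A, valueFn p r π s

/-- The optimal action-value function `q_★(s,a) = max_π q_π(s,a)`. -/
def qStar (p : S → A → S → ℝ) (r : S → A → ℝ) (s : S) (a : A) : ℝ :=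
  ⨆ π : S → A, qFn p r π s a

/-- A policy is optimal if its value function equals the optimal value function. -/
def IsOptimal (p : S → A → S → ℝ) (r : S → A → ℝ) (π : S → A) : Prop :=
  ∀ s, valueFn p r π s = vStar p r s

/-- A policy `π'` is greedy w.r.t. `Q : S → A → ℝ` if `π' s` maximizes `Q s ·`
for every state `s`. -/
def IsGreedy (Q : S → A → ℝ) (π' : S → A) : Prop := ∀ s a, Q s a ≤ Q s (π' s)

/-- The vector `w`: maximal expected episode length, `w(s) = max_π ((I−Q_π)⁻¹ 𝟙)(s)`. -/
def wVec (p : S → A → S → ℝ) (s : S) : ℝ :=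
  ⨆ π : S → A, ((1 - Qmat p π)⁻¹ *ᵥ (fun _ => (1 : ℝ))) s

/-- `‖w‖_∞ = max_s w(s)`. -/
def wNorm (p : S → A → S → ℝ) : ℝ := ⨆ s : S, wVec p s

/-- The suboptimality gap of an action-value function `q`:
`min_s [max_a q(s,a) − max_{a not maximizing q(s,·)} q(s,a)]`. -/
def gapOf (q : S → A → ℝ) : ℝ :=
  ⨅ s : S, ((⨆ a : A, q s a) - sSup (q s '' {a | q s a < ⨆ a' : A, q s a'}))

/-- The optimal suboptimality gap `Δ_★`. -/
def gapStar (p : S → A → S → ℝ) (r : S → A → ℝ) : ℝ := gapOf (qStar p r)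

/-- The minimum suboptimality gap `Δ = min_π Δ(π)`. -/
def gapMin (p : S → A → S → ℝ) (r : S → A → ℝ) : ℝ :=
  ⨅ π : S → A, gapOf (qFn p r π)

/-- All policies are proper: `Q_π^k → 0` entrywise as `k → ∞` for every policy. -/
def AllProper (p : S → A → S → ℝ) : Prop :=
  ∀ π : S → A, Tendsto (fun k => (Qmat p π) ^ k) atTop (nhds 0)

/-- `p` is a family of subprobability vectors and `r` takes values in `[0,1]`. -/
def IsMDP (p : S → A → S → ℝ) (r : S → A → ℝ) : Prop :=
  (∀ s a, r s a ∈ Set.Icc (0 : ℝ) 1) ∧ (∀ s a s', 0 ≤ p s a s') ∧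
    (∀ s a, ∑ s', p s a s' ≤ 1)

end MCES

open MCES

namespace MCES

variable {S A : Type*} [Fintype S] {p : S → A → S → ℝ} {r : S → A → ℝ}

lemma Qmat_mulVec_apply (p : S → A → S → ℝ) (π : S → A) (x : S → ℝ) (s : S) :
    (Qmat p π *ᵥ x) s = ∑ s', p s (π s) s' * x s' := rfl

lemma Qmat_mulVec_mono (hp : ∀ s a s', 0 ≤ p s a s') (π : S → A) {x y : S → ℝ} (h : x ≤ y) :
    Qmat p π *ᵥ x ≤ Qmat p π *ᵥ y := fun s =>
  Finset.sum_le_sum fun s' _ => mul_le_mul_of_nonneg_left (h s') (hp s (π s) s')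

variable [DecidableEq S]

lemma tendsto_Qmat_pow_mulVec (hproper : AllProper p) (π : S → A) (x : S → ℝ) :
    Tendsto (fun k => (Qmat p π ^ k) *ᵥ x) atTop (nhds 0) := by
  have hcont : Continuous fun M : Matrix S S ℝ => M *ᵥ x :=
    continuous_id.matrix_mulVec continuous_const
  have h := (hcont.tendsto 0).comp (hproper π)
  rwa [zero_mulVec] at h

lemma Qmat_pow_mulVec_mono (hp : ∀ s a s', 0 ≤ p s a s') (π : S → A) {x y : S → ℝ}
    (h : x ≤ y) (k : ℕ) : (Qmat p π ^ k) *ᵥ x ≤ (Qmat p π ^ k) *ᵥ y := by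
  induction k with
  | zero => simpa using h
  | succ k ih =>
    rw [pow_succ', ← mulVec_mulVec, ← mulVec_mulVec]
    exact Qmat_mulVec_mono hp π ih

/-- The maximum principle for a proper policy. -/
lemma nonneg_of_Qmat_mulVec_le (hp : ∀ s a s', 0 ≤ p s a s') (hproper : AllProper p)
    (π : S → A) {x : S → ℝ} (h : Qmat p π *ᵥ x ≤ x) : 0 ≤ x := by
  have hk : ∀ k : ℕ, (Qmat p π ^ k) *ᵥ x ≤ x := by
    intro k
    induction k with
    | zero => simp
    | succ k ih =>
      rw [pow_succ', ← mulVec_mulVec]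
      exact (Qmat_mulVec_mono hp π ih).trans h
  exact le_of_tendsto (tendsto_Qmat_pow_mulVec hproper π x) (Eventually.of_forall hk)

lemma isUnit_one_sub_Qmat (hproper : AllProper p) (π : S → A) : IsUnit (1 - Qmat p π) := by
  rw [← mulVec_injective_iff_isUnit]
  intro x y hxy
  have hfix : Qmat p π *ᵥ (x - y) = x - y := by
    have h : (1 - Qmat p π) *ᵥ (x - y) = 0 := by
      rw [mulVec_sub]
      exact sub_eq_zero.2 hxy
    rw [sub_mulVec, one_mulVec] at h
    exact (sub_eq_zero.1 h).symm
  have hk : ∀ k : ℕ, (Qmat p π ^ k) *ᵥ (x - y) = x - y := by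
    intro k
    induction k with
    | zero => simp
    | succ k ih => rw [pow_succ', ← mulVec_mulVec, ih, hfix]
  have h := tendsto_Qmat_pow_mulVec hproper π (x - y)
  simp only [hk] at h
  exact sub_eq_zero.1 (tendsto_nhds_unique tendsto_const_nhds h)

lemma valueFn_eq_add (hproper : AllProper p) (r : S → A → ℝ) (π : S → A) :
    valueFn p r π = rvec r π + Qmat p π *ᵥ valueFn p r π := by
  have hdet : IsUnit (1 - Qmat p π).det :=
    (isUnit_iff_isUnit_det _).1 (isUnit_one_sub_Qmat hproper π)
  have h : (1 - Qmat p π) *ᵥ valueFn p r π = rvec r π := by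
    rw [valueFn, mulVec_mulVec, mul_nonsing_inv _ hdet, one_mulVec]
  rw [sub_mulVec, one_mulVec] at h
  rw [← h, sub_add_cancel]

/-- The Bellman equation of a policy. -/
lemma valueFn_eq_qFn (hproper : AllProper p) (r : S → A → ℝ) (π : S → A) (s : S) :
    valueFn p r π s = qFn p r π s (π s) :=
  congrFun (valueFn_eq_add hproper r π) s

lemma valueFn_le_of_supersolution (hp : ∀ s a s', 0 ≤ p s a s') (hproper : AllProper p)
    {π : S → A} {x : S → ℝ} (h : ∀ s, r s (π s) + ∑ s', p s (π s) s' * x s' ≤ x s) (s : S) :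
    valueFn p r π s ≤ x s := by
  have hnonneg : 0 ≤ x - valueFn p r π := by
    refine nonneg_of_Qmat_mulVec_le hp hproper π fun t => ?_
    rw [mulVec_sub]
    have h₁ : valueFn p r π t = r t (π t) + (Qmat p π *ᵥ valueFn p r π) t :=
      congrFun (valueFn_eq_add hproper r π) t
    have h₂ := h t
    rw [← Qmat_mulVec_apply] at h₂
    simp only [Pi.sub_apply]
    linarith
  exact sub_nonneg.1 (hnonneg s)

lemma le_valueFn_of_subsolution (hp : ∀ s a s', 0 ≤ p s a s') (hproper : AllProper p)
    {π : S → A} {x : S → ℝ} (h : ∀ s, x s ≤ r s (π s) + ∑ s', p s (π s) s' * x s') (s : S) :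
    x s ≤ valueFn p r π s := by
  have hnonneg : 0 ≤ valueFn p r π - x := by
    refine nonneg_of_Qmat_mulVec_le hp hproper π fun t => ?_
    rw [mulVec_sub]
    have h₁ : valueFn p r π t = r t (π t) + (Qmat p π *ᵥ valueFn p r π) t :=
      congrFun (valueFn_eq_add hproper r π) t
    have h₂ := h t
    rw [← Qmat_mulVec_apply] at h₂
    simp only [Pi.sub_apply]
    linarith
  exact sub_nonneg.1 (hnonneg s)

lemma qFn_mono (hp : ∀ s a s', 0 ≤ p s a s') {π μ : S → A}
    (h : ∀ s, valueFn p r π s ≤ valueFn p r μ s) (s : S) (a : A) :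
    qFn p r π s a ≤ qFn p r μ s a :=
  add_le_add_right (Finset.sum_le_sum fun s' _ => mul_le_mul_of_nonneg_left (h s') (hp s a s')) _

/-- Policy improvement. -/
lemma valueFn_le_of_isGreedy (hp : ∀ s a s', 0 ≤ p s a s') (hproper : AllProper p)
    {π μ : S → A} (h : IsGreedy (qFn p r π) μ) (s : S) :
    valueFn p r π s ≤ valueFn p r μ s :=
  le_valueFn_of_subsolution hp hproper
    (fun t => (valueFn_eq_qFn hproper r π t).trans_le (h t (π t))) s

lemma qFn_le_valueFn_of_isGreedy (hp : ∀ s a s', 0 ≤ p s a s') (hproper : AllProper p)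
    {π μ : S → A} (h : IsGreedy (qFn p r π) μ) (s : S) (a : A) :
    qFn p r π s a ≤ valueFn p r μ s := by
  rw [valueFn_eq_qFn hproper r μ s]
  exact (h s a).trans (qFn_mono hp (valueFn_le_of_isGreedy hp hproper h) s (μ s))

lemma exists_isGreedy {S A : Type*} [Finite A] [Nonempty A] (Q : S → A → ℝ) : ∃ μ, IsGreedy Q μ := by
  choose μ hμ using fun s => Finite.exists_max (Q s)
  exact ⟨μ, hμ⟩

/-- Some policy satisfies the Bellman optimality inequality. -/
lemma exists_forall_qFn_le_valueFn [Finite A] [Nonempty A] (hp : ∀ s a s', 0 ≤ p s a s')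
    (hproper : AllProper p) (r : S → A → ℝ) :
    ∃ π : S → A, ∀ s a, qFn p r π s a ≤ valueFn p r π s := by
  obtain ⟨π, hπ⟩ := Finite.exists_max fun π : S → A => ∑ s, valueFn p r π s
  obtain ⟨μ, hμ⟩ := exists_isGreedy (qFn p r π)
  refine ⟨π, fun s a => ?_⟩
  have hle := valueFn_le_of_isGreedy hp hproper hμ
  have heq := (Finset.sum_eq_sum_iff_of_le fun t _ => hle t).1
    ((Finset.sum_le_sum fun t _ => hle t).antisymm (hπ μ)) s (Finset.mem_univ s)
  rw [heq]
  exact qFn_le_valueFn_of_isGreedy hp hproper hμ s a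

lemma valueFn_le_valueFn_of_qFn_le (hp : ∀ s a s', 0 ≤ p s a s') (hproper : AllProper p)
    {π : S → A} (h : ∀ s a, qFn p r π s a ≤ valueFn p r π s) (μ : S → A) (s : S) :
    valueFn p r μ s ≤ valueFn p r π s :=
  valueFn_le_of_supersolution hp hproper (fun t => h t (μ t)) s

lemma vStar_eq_valueFn [Finite A] (hp : ∀ s a s', 0 ≤ p s a s') (hproper : AllProper p)
    {π : S → A} (h : ∀ s a, qFn p r π s a ≤ valueFn p r π s) (s : S) :
    vStar p r s = valueFn p r π s :=
  have : Nonempty (S → A) := ⟨π⟩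
  (ciSup_le fun μ => valueFn_le_valueFn_of_qFn_le hp hproper h μ s).antisymm
    (le_ciSup (f := fun μ => valueFn p r μ s) (Set.finite_range _).bddAbove π)

lemma qStar_eq_qFn [Finite A] (hp : ∀ s a s', 0 ≤ p s a s') (hproper : AllProper p)
    {π : S → A} (h : ∀ s a, qFn p r π s a ≤ valueFn p r π s) (s : S) (a : A) :
    qStar p r s a = qFn p r π s a :=
  have : Nonempty (S → A) := ⟨π⟩
  (ciSup_le fun μ => qFn_mono hp (valueFn_le_valueFn_of_qFn_le hp hproper h μ) s a).antisymm
    (le_ciSup (f := fun μ => qFn p r μ s a) (Set.finite_range _).bddAbove π)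

lemma ciSup_qStar_eq_vStar [Finite A] [Nonempty A] (hp : ∀ s a s', 0 ≤ p s a s')
    (hproper : AllProper p) (s : S) : ⨆ a, qStar p r s a = vStar p r s := by
  obtain ⟨π, hπ⟩ := exists_forall_qFn_le_valueFn hp hproper r
  rw [vStar_eq_valueFn hp hproper hπ]
  simp only [qStar_eq_qFn hp hproper hπ]
  refine (ciSup_le (hπ s)).antisymm ?_
  rw [valueFn_eq_qFn hproper r π s]
  exact le_ciSup (f := qFn p r π s) (Set.finite_range _).bddAbove (π s)

lemma gapOf_le_sub {S A : Type*} [Finite S] [Finite A] {q : S → A → ℝ} {s : S} {a : A}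
    (h : q s a < ⨆ a', q s a') : gapOf q ≤ (⨆ a', q s a') - q s a := by
  have h₁ : q s a ≤ sSup (q s '' {a | q s a < ⨆ a', q s a'}) :=
    le_csSup ((Set.toFinite _).image _).bddAbove ⟨a, h, rfl⟩
  have h₂ : gapOf q ≤ (⨆ a', q s a') - sSup (q s '' {a | q s a < ⨆ a', q s a'}) :=
    ciInf_le (Set.finite_range _).bddBelow s
  linarith

/-- A policy whose value is within less than the gap of `v_★` is optimal. -/
lemma isOptimal_of_vStar_sub_lt_gapStar [Finite A] [Nonempty A] (hp : ∀ s a s', 0 ≤ p s a s')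
    (hproper : AllProper p) {μ : S → A}
    (h : ∀ s, vStar p r s - valueFn p r μ s < gapStar p r) : IsOptimal p r μ := by
  obtain ⟨π, hπ⟩ := exists_forall_qFn_le_valueFn hp hproper r
  have hmax : ∀ s, vStar p r s ≤ qStar p r s (μ s) := by
    intro s
    by_contra! hlt
    have hgap := gapOf_le_sub (q := qStar p r) (s := s) (a := μ s)
      (by rwa [ciSup_qStar_eq_vStar hp hproper])
    rw [ciSup_qStar_eq_vStar hp hproper, qStar_eq_qFn hp hproper hπ] at hgap
    have hq := qFn_mono hp (valueFn_le_valueFn_of_qFn_le hp hproper hπ μ) s (μ s)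
    rw [← valueFn_eq_qFn hproper r μ s] at hq
    have hs := h s
    rw [gapStar] at hs
    linarith
  intro s
  rw [vStar_eq_valueFn hp hproper hπ]
  refine (valueFn_le_valueFn_of_qFn_le hp hproper hπ μ s).antisymm ?_
  refine le_valueFn_of_subsolution hp hproper (fun t => ?_) s
  have ht := hmax t
  rwa [vStar_eq_valueFn hp hproper hπ, qStar_eq_qFn hp hproper hπ] at ht

lemma wVec_eq_vStar (p : S → A → S → ℝ) : wVec p = vStar p fun _ _ => 1 := rfl

lemma one_add_sum_wVec_le [Finite A] [Nonempty A] (hp : ∀ s a s', 0 ≤ p s a s')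
    (hproper : AllProper p) (s : S) (a : A) : 1 + ∑ s', p s a s' * wVec p s' ≤ wVec p s := by
  obtain ⟨π, hπ⟩ := exists_forall_qFn_le_valueFn hp hproper fun _ _ => 1
  simp only [wVec_eq_vStar, vStar_eq_valueFn hp hproper hπ]
  exact hπ s a

lemma one_le_wVec [Finite A] [Nonempty A] (hp : ∀ s a s', 0 ≤ p s a s')
    (hproper : AllProper p) (s : S) : 1 ≤ wVec p s := by
  obtain ⟨π, hπ⟩ := exists_forall_qFn_le_valueFn hp hproper fun _ _ => 1
  rw [wVec_eq_vStar, vStar_eq_valueFn hp hproper hπ]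
  refine le_valueFn_of_subsolution (x := fun _ => 1) hp hproper (fun t => ?_) s
  simpa using Finset.sum_nonneg fun s' _ => hp t (π t) s'

lemma wVec_le_wNorm (p : S → A → S → ℝ) (s : S) : wVec p s ≤ wNorm p :=
  le_ciSup (Set.finite_range _).bddAbove s

lemma one_le_wNorm [Nonempty S] [Finite A] [Nonempty A] (hp : ∀ s a s', 0 ≤ p s a s')
    (hproper : AllProper p) : 1 ≤ wNorm p :=
  (one_le_wVec hp hproper (Classical.arbitrary S)).trans (wVec_le_wNorm p _)

lemma Qmat_pow_mulVec_one_le (hp : ∀ s a s', 0 ≤ p s a s') (hsub : ∀ s a, ∑ s', p s a s' ≤ 1)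
    (π : S → A) (k : ℕ) : (Qmat p π ^ k) *ᵥ (fun _ => (1 : ℝ)) ≤ fun _ => 1 := by
  induction k with
  | zero => simp
  | succ k ih =>
    rw [pow_succ', ← mulVec_mulVec]
    refine (Qmat_mulVec_mono hp π ih).trans fun s => ?_
    simpa [Qmat_mulVec_apply] using hsub s (π s)

lemma wNorm_le_div [Nonempty S] [Finite A] [Nonempty A] (hp : ∀ s a s', 0 ≤ p s a s')
    (hsub : ∀ s a, ∑ s', p s a s' ≤ 1) (hproper : AllProper p) {η : ℝ} (hη : 0 < η) {K : ℕ}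
    (hQK : ∀ π : S → A, ‖(Qmat p π ^ K) *ᵥ (fun _ => (1 : ℝ))‖ ≤ 1 - η) :
    wNorm p ≤ K / η := by
  obtain ⟨π, hπ⟩ := exists_forall_qFn_le_valueFn hp hproper fun _ _ => 1
  have hw : wVec p = valueFn p (fun _ _ => 1) π :=
    funext fun s => vStar_eq_valueFn hp hproper hπ s
  have hbell : wVec p = (fun _ => 1) + Qmat p π *ᵥ wVec p := by
    rw [hw]
    exact valueFn_eq_add hproper _ π
  have hunroll : ∀ (k : ℕ) (s : S), wVec p s ≤ k + ((Qmat p π ^ k) *ᵥ wVec p) s := by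
    intro k s
    induction k with
    | zero => simp
    | succ k ih =>
      have h₁ : ((Qmat p π ^ k) *ᵥ wVec p) s =
          ((Qmat p π ^ k) *ᵥ (fun _ => (1 : ℝ))) s + ((Qmat p π ^ (k + 1)) *ᵥ wVec p) s := by
        conv_lhs => rw [hbell]
        rw [mulVec_add, mulVec_mulVec, ← pow_succ, Pi.add_apply]
      have h₂ : ((Qmat p π ^ k) *ᵥ (fun _ => (1 : ℝ))) s ≤ 1 :=
        Qmat_pow_mulVec_one_le hp hsub π k s
      push_cast
      linarith
  have hW : 0 ≤ wNorm p := zero_le_one.trans (one_le_wNorm hp hproper)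
  have hcontract : wNorm p ≤ K + (1 - η) * wNorm p := by
    refine ciSup_le fun s => (hunroll K s).trans ?_
    have h₁ := Qmat_pow_mulVec_mono hp π (x := wVec p) (y := wNorm p • fun _ => (1 : ℝ))
      (fun t => by simpa using wVec_le_wNorm p t) K s
    rw [mulVec_smul, Pi.smul_apply, smul_eq_mul] at h₁
    have h₂ : ((Qmat p π ^ K) *ᵥ (fun _ => (1 : ℝ))) s ≤ 1 - η :=
      (le_abs_self _).trans ((norm_le_pi_norm _ s).trans (hQK π))
    have h₃ := mul_le_mul_of_nonneg_left h₂ hW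
    linarith
  rw [le_div_iff₀ hη]
  linarith

/-- Exact policy iteration converges geometrically in the `w`-weighted sup norm. -/
lemma vStar_sub_valueFn_le [Finite A] [Nonempty A] (hmdp : IsMDP p r) (hproper : AllProper p)
    {M : ℝ} (hM : 1 ≤ M) (hwM : ∀ s, wVec p s ≤ M) {π : ℕ → S → A}
    (hπ : ∀ k, IsGreedy (qFn p r (π k)) (π (k + 1))) (k : ℕ) (s : S) :
    vStar p r s - valueFn p r (π k) s ≤ (1 - 1 / M) ^ k * wVec p s := by
  obtain ⟨hr, hp, -⟩ := hmdp
  have hM0 : 0 < M := by linarith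
  have hγ : 0 ≤ 1 - 1 / M := sub_nonneg.2 ((div_le_one hM0).2 hM)
  obtain ⟨μ, hμ⟩ := exists_forall_qFn_le_valueFn hp hproper r
  simp only [vStar_eq_valueFn hp hproper hμ]
  induction k generalizing s with
  | zero =>
    have h₁ : valueFn p r μ s ≤ wVec p s :=
      valueFn_le_of_supersolution hp hproper (fun t => by
        have := one_add_sum_wVec_le hp hproper t (μ t)
        have := (hr t (μ t)).2
        linarith) s
    have h₂ : 0 ≤ valueFn p r (π 0) s :=
      le_valueFn_of_subsolution (x := fun _ => 0) hp hproper
        (fun t => by simpa using (hr t (π 0 t)).1) s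
    rw [pow_zero, one_mul]
    linarith
  | succ k ih =>
    have h₁ := qFn_le_valueFn_of_isGreedy hp hproper (hπ k) s (μ s)
    have h₂ := valueFn_eq_qFn hproper r μ s
    have h₃ : qFn p r μ s (μ s) - qFn p r (π k) s (μ s) ≤
        (1 - 1 / M) ^ k * ∑ s', p s (μ s) s' * wVec p s' := by
      rw [qFn, qFn, add_sub_add_left_eq_sub, ← Finset.sum_sub_distrib, Finset.mul_sum]
      refine Finset.sum_le_sum fun s' _ => ?_
      rw [← mul_sub, mul_left_comm]
      exact mul_le_mul_of_nonneg_left (ih s') (hp s (μ s) s')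
    have h₄ : ∑ s', p s (μ s) s' * wVec p s' ≤ (1 - 1 / M) * wVec p s := by
      have h₅ := one_add_sum_wVec_le hp hproper s (μ s)
      have h₆ : wVec p s / M ≤ 1 := (div_le_one hM0).2 (hwM s)
      have h₇ : (1 - 1 / M) * wVec p s = wVec p s - wVec p s / M := by ring
      linarith
    have h₈ := mul_le_mul_of_nonneg_left h₄ (pow_nonneg hγ k)
    rw [pow_succ, mul_assoc]
    linarith

lemma one_sub_inv_pow_mul_lt {M δ : ℝ} (hM : 1 < M) (hδ : 0 < δ) (hδ₁ : δ ≤ 1) {k : ℕ}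
    (hk : 2 * M * Real.log (M / δ) ≤ k) : (1 - 1 / M) ^ k * M < δ := by
  have hM0 : 0 < M := by linarith
  have h₁ : (1 - 1 / M) ^ k ≤ Real.exp (-(k / M)) := by
    have h := pow_le_pow_left₀ (sub_nonneg.2 ((div_le_one hM0).2 hM.le))
      (Real.one_sub_le_exp_neg (1 / M)) k
    rwa [← Real.exp_nat_mul, show (k : ℝ) * -(1 / M) = -(k / M) by ring] at h
  have h₂ : Real.exp (-(k / M)) ≤ (δ / M) ^ 2 := by
    have hlog : 2 * Real.log (M / δ) ≤ k / M := by
      rw [le_div_iff₀ hM0]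
      linarith
    have hexp : Real.exp (-(2 * Real.log (M / δ))) = (δ / M) ^ 2 := by
      rw [← mul_neg, ← Real.log_inv, inv_div, two_mul, Real.exp_add,
        Real.exp_log (div_pos hδ hM0), sq]
    rw [← hexp]
    exact Real.exp_le_exp.2 (neg_le_neg hlog)
  calc (1 - 1 / M) ^ k * M ≤ (δ / M) ^ 2 * M :=
        mul_le_mul_of_nonneg_right (h₁.trans h₂) hM0.le
    _ = δ * (δ / M) := by field_simp
    _ < δ * 1 := mul_lt_mul_of_pos_left ((div_lt_one hM0).2 (hδ₁.trans_lt hM)) hδ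
    _ = δ := mul_one δ

end MCES

/-- **The sampled iteration count dominates the exact policy-iteration count.**
Let `η ∈ (0,1)` and `K ≥ 1` an integer with `‖Q_π^K 𝟙‖_∞ ≤ 1 − η` for every
policy `π`, and assume `0 < Δ_★ ≤ 1`.  Then `‖w‖_∞ ≤ K/η`,
`⌈2‖w‖_∞ log(‖w‖_∞/Δ_★)⌉ ≤ ⌈(2K/η) log(K/(η Δ_★))⌉`, and exact policy
iteration from any initial policy yields an optimal policy after
`⌈(2K/η) log(K/(η Δ_★))⌉` steps. -/
theorem sampled_iteration_count_dominates
    {S A : Type*} [Fintype S] [DecidableEq S] [Fintype A] [Nonempty S] [Nonempty A]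
    (p : S → A → S → ℝ) (r : S → A → ℝ)
    (hmdp : IsMDP p r) (hproper : AllProper p)
    (hsubopt : ∀ s : S, ∃ a, qStar p r s a < ⨆ a' : A, qStar p r s a')
    (hΔpos : 0 < gapStar p r) (hΔle : gapStar p r ≤ 1)
    (η : ℝ) (hη : η ∈ Set.Ioo (0 : ℝ) 1) (K : ℕ) (hK : 1 ≤ K)
    (hQK : ∀ π : S → A, ‖(Qmat p π ^ K) *ᵥ (fun _ => (1 : ℝ))‖ ≤ 1 - η) :
    wNorm p ≤ (K : ℝ) / η ∧
    ⌈2 * wNorm p * Real.log (wNorm p / gapStar p r)⌉₊ ≤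
      ⌈(2 * K / η) * Real.log (K / (η * gapStar p r))⌉₊ ∧
    ∀ π : ℕ → S → A, (∀ k, IsGreedy (qFn p r (π k)) (π (k + 1))) →
      ∀ k : ℕ, ⌈(2 * K / η) * Real.log (K / (η * gapStar p r))⌉₊ ≤ k →
        IsOptimal p r (π k) := by
  obtain ⟨hr, hp, hsub⟩ := id hmdp
  have hK' : (1 : ℝ) ≤ K := by exact_mod_cast hK
  have hM : 1 < (K : ℝ) / η := (one_lt_div hη.1).2 (hη.2.trans_le hK')
  have hW := wNorm_le_div hp hsub hproper hη.1 hQK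
  have hW₁ := one_le_wNorm hp hproper
  have hdiv : (K : ℝ) / (η * gapStar p r) = K / η / gapStar p r := (div_div _ _ _).symm
  rw [hdiv, mul_div_assoc]
  refine ⟨hW, Nat.ceil_mono ?_, fun π hπ k hk => ?_⟩
  · have hlog : 0 ≤ Real.log (wNorm p / gapStar p r) :=
      Real.log_nonneg ((one_le_div hΔpos).2 (hΔle.trans hW₁))
    have hWpos : 0 < wNorm p / gapStar p r := div_pos (by linarith) hΔpos
    gcongr
  · refine isOptimal_of_vStar_sub_lt_gapStar hp hproper fun s => ?_
    have hwM : ∀ t, wVec p t ≤ K / η := fun t => (wVec_le_wNorm p t).trans hW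
    have hγ : 0 ≤ 1 - 1 / ((K : ℝ) / η) :=
      sub_nonneg.2 ((div_le_one (by linarith)).2 hM.le)
    exact (vStar_sub_valueFn_le hmdp hproper hM.le hwM hπ k s).trans_lt
      ((mul_le_mul_of_nonneg_left (hwM s) (pow_nonneg hγ k)).trans_lt
        (one_sub_inv_pow_mul_lt hM hΔpos hΔle (Nat.ceil_le.1 hk)))
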